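/- arXiv:2405.02164 — 2 statements merged into one kernel-verified Lean document; each statement's English description precedes it below -/
import Mathlib

section
/- For n ≥ 1, Σ_{λ⊢n} [n(n-1)⋯(n-ℓ(λ)+2)/(m_1!⋯m_n!)] · multinomial(n; λ_1, λ_2, ..., λ_ℓ) = (n+1)^{n-1}, where the sum is over all partitions λ of n, λ has m_i parts equal to i and ℓ = ℓ(λ) parts in total, and multinomial(n; λ) = n!/(λ_1!⋯λ_ℓ!). -/
open Finset in
/-- Coefficient extraction from the `(n+1)`-st power of the truncated exponential. -/
lemma aux_coeff (n : ℕ) :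
    ∑ k ∈ (piAntidiag (range (n + 1)) (n + 1)).filter
        (fun k => ∑ i ∈ range (n + 1), i * k i = n),
      (Nat.multinomial (range (n + 1)) k : ℚ) *
        ∏ i ∈ range (n + 1), (1 / (i.factorial : ℚ)) ^ k i =
      ((n : ℚ) + 1) ^ n / n.factorial := by
  have h1 : PowerSeries.coeff n
      ((∑ i ∈ range (n + 1), PowerSeries.monomial i (1 / (i.factorial : ℚ))) ^ (n + 1)) =
      ((n : ℚ) + 1) ^ n / n.factorial := by
    have h2 : (∑ i ∈ range (n + 1), PowerSeries.monomial i (1 / (i.factorial : ℚ))) =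
        ((PowerSeries.trunc (n + 1) (PowerSeries.exp ℚ) : Polynomial ℚ) : PowerSeries ℚ) := by
      ext m
      simp [PowerSeries.coeff_monomial, PowerSeries.coeff_trunc, PowerSeries.coeff_exp]
    rw [h2, ← PowerSeries.coeff_coe_trunc_of_lt n.lt_succ_self, PowerSeries.trunc_trunc_pow,
      PowerSeries.coeff_coe_trunc_of_lt n.lt_succ_self, PowerSeries.exp_pow_eq_rescale_exp]
    simp [PowerSeries.coeff_rescale, PowerSeries.coeff_exp, div_eq_mul_inv]
  rw [← h1, sum_pow_eq_sum_piAntidiag, map_sum, sum_filter]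
  refine sum_congr rfl fun k _ => ?_
  have h3 : ∀ s : Finset ℕ,
      ∏ i ∈ s, (PowerSeries.monomial i (1 / (i.factorial : ℚ))) ^ k i =
      PowerSeries.monomial (∑ i ∈ s, i * k i) (∏ i ∈ s, (1 / (i.factorial : ℚ)) ^ k i) := by
    intro s
    induction s using Finset.induction_on with
    | empty => simp
    | insert a s ha ih =>
      rw [prod_insert ha, sum_insert ha, prod_insert ha, ih, PowerSeries.monomial_pow,
        PowerSeries.monomial_mul_monomial]
      congr 2
      ring
  rw [h3, ← map_natCast (PowerSeries.C (R := ℚ)), PowerSeries.coeff_C_mul,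
    PowerSeries.coeff_monomial]
  by_cases h : ∑ i ∈ range (n + 1), i * k i = n
  · simp [h]
  · simp [h, Ne.symm h]

/-- The exponent vector of a partition, padded at `0`. -/
def auxK (n : ℕ) (lam : n.Partition) (i : ℕ) : ℕ :=
  if i = 0 then n + 1 - lam.parts.card else lam.parts.count i

lemma aux_card_le {n : ℕ} (lam : n.Partition) : lam.parts.card ≤ n := by
  have h := Multiset.card_nsmul_le_sum (s := lam.parts) (a := 1)
    (fun x hx => lam.parts_pos hx)
  simpa [lam.parts_sum] using h

lemma aux_count_zero {n : ℕ} (lam : n.Partition) : lam.parts.count 0 = 0 :=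
  Multiset.count_eq_zero_of_notMem fun h => (lam.parts_pos h).ne rfl

lemma aux_mem {n : ℕ} (lam : n.Partition) : ∀ a ∈ lam.parts, a ∈ Finset.range (n + 1) := by
  intro a ha
  have := lam.le_of_mem_parts ha
  simp; omega

lemma aux_sum_count {n : ℕ} (lam : n.Partition) :
    ∑ i ∈ Finset.range n, lam.parts.count (i + 1) = lam.parts.card := by
  have h := Multiset.sum_count_eq_card (aux_mem lam)
  rwa [Finset.sum_range_succ', aux_count_zero, add_zero] at h

lemma aux_falling (n l : ℕ) (h1 : 1 ≤ l) (h2 : l ≤ n) :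
    ((n : ℚ) + 1) * (∏ j ∈ Finset.range (l - 1), ((n : ℚ) - j)) *
      ((n + 1 - l).factorial : ℚ) = ((n + 1).factorial : ℚ) := by
  obtain ⟨l, rfl⟩ : ∃ m, l = m + 1 := ⟨l - 1, by omega⟩
  clear h1
  induction l with
  | zero => simp [Nat.factorial_succ]
  | succ l ih =>
    rw [← ih (by omega)]
    have e : n + 1 - (l + 1) = (n + 1 - (l + 1 + 1)) + 1 := by omega
    rw [e, Nat.factorial_succ]
    have e2 : ((n + 1 - (l + 1 + 1) + 1 : ℕ) : ℚ) = (n : ℚ) - l := by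
      rw [← e, Nat.cast_sub (by omega)]; push_cast; ring
    simp only [Nat.add_sub_cancel, Nat.cast_mul, e2, Finset.prod_range_succ]
    ring

lemma aux_term (n : ℕ) (hn : 1 ≤ n) (lam : n.Partition) :
    ((∏ j ∈ Finset.range (lam.parts.card - 1), ((n : ℚ) - j)) /
        ∏ i ∈ Finset.range (n + 1), ((lam.parts.count i).factorial : ℚ)) *
        ((n.factorial : ℚ) / (lam.parts.map (fun p => (p.factorial : ℚ))).prod) =
    ((n.factorial : ℚ) / (n + 1)) *
      ((Nat.multinomial (Finset.range (n + 1)) (auxK n lam) : ℚ) *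
        ∏ i ∈ Finset.range (n + 1), (1 / (i.factorial : ℚ)) ^ auxK n lam i) := by
  have hl := aux_card_le lam
  have hl1 : 1 ≤ lam.parts.card := by
    rw [Nat.one_le_iff_ne_zero]
    intro h
    have := lam.parts_sum
    rw [Multiset.card_eq_zero.mp h] at this
    simp at this; omega
  have hf := aux_falling n _ hl1 hl
  have hsum : ∑ i ∈ Finset.range (n + 1), auxK n lam i = n + 1 := by
    rw [Finset.sum_range_succ']
    simp only [auxK, Nat.succ_ne_zero, if_false, if_true, aux_sum_count]
    omega
  have hm := Nat.multinomial_spec (Finset.range (n + 1)) (auxK n lam)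
  rw [hsum, Finset.prod_range_succ'] at hm
  simp only [auxK, Nat.succ_ne_zero, if_false, if_true] at hm
  have hm' := congrArg (Nat.cast : ℕ → ℚ) hm
  rw [← hf] at hm'
  push_cast at hm'
  have hp : (lam.parts.map (fun p => (p.factorial : ℚ))).prod =
      ∏ i ∈ Finset.range n, ((i + 1).factorial : ℚ) ^ lam.parts.count (i + 1) := by
    rw [Finset.prod_multiset_map_count,
      Finset.prod_subset (s₂ := Finset.range (n + 1))
        (fun a ha => aux_mem lam a (by simpa using ha))
        (fun a _ ha => by
          rw [Multiset.count_eq_zero_of_notMem (by simpa using ha), pow_zero]),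
      Finset.prod_range_succ', aux_count_zero]
    simp
  rw [hp, Finset.prod_range_succ', Finset.prod_range_succ' (n := n), aux_count_zero]
  have hq : ∏ i ∈ Finset.range n, (1 / ((i + 1).factorial : ℚ)) ^ auxK n lam (i + 1) =
      1 / ∏ i ∈ Finset.range n, ((i + 1).factorial : ℚ) ^ lam.parts.count (i + 1) := by
    simp [auxK]
  rw [hq]
  have hA : ∏ i ∈ Finset.range n, ((lam.parts.count (i + 1)).factorial : ℚ) ≠ 0 :=
    Finset.prod_ne_zero_iff.mpr fun i _ => by positivity
  have hB : ∏ i ∈ Finset.range n, ((i + 1).factorial : ℚ) ^ lam.parts.count (i + 1) ≠ 0 :=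
    Finset.prod_ne_zero_iff.mpr fun i _ => by positivity
  have hC : ((n + 1 - lam.parts.card).factorial : ℚ) ≠ 0 := by positivity
  have hD : (n : ℚ) + 1 ≠ 0 := by positivity
  change _ * _ * (Nat.multinomial (Finset.range (n + 1)) (auxK n lam) : ℚ) = _ at hm'
  generalize (Nat.multinomial (Finset.range (n + 1)) (auxK n lam) : ℚ) = M at *
  generalize ∏ i ∈ Finset.range n, ((lam.parts.count (i + 1)).factorial : ℚ) = A at *
  generalize ∏ i ∈ Finset.range n, ((i + 1).factorial : ℚ) ^ lam.parts.count (i + 1) = B at *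
  generalize ∏ j ∈ Finset.range (lam.parts.card - 1), ((n : ℚ) - j) = F at *
  have hm2 : A * M = ((n : ℚ) + 1) * F := by
    apply mul_right_cancel₀ hC
    linarith
  have hF : F = A * M / (n + 1) := by field_simp; linarith
  rw [hF]
  simp
  field_simp

/-- For `n ≥ 1`,
`Σ_{λ ⊢ n} [n(n-1)⋯(n-ℓ+2)/(m₁!⋯m_n!)]·(n!/(λ₁!⋯λ_ℓ!)) = (n+1)^(n-1)`,
where `ℓ = ℓ(λ)` and `λ` has `m_i` parts equal to `i`.  The falling product
`n(n-1)⋯(n-ℓ+2)` has `ℓ-1` factors. -/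
theorem statement12 (n : ℕ) (hn : 1 ≤ n) :
    ∑ lam : n.Partition,
      ((∏ j ∈ Finset.range (lam.parts.card - 1), ((n : ℚ) - j)) /
        ∏ i ∈ Finset.range (n + 1), ((lam.parts.count i).factorial : ℚ)) *
        ((n.factorial : ℚ) / (lam.parts.map (fun p => (p.factorial : ℚ))).prod) =
      ((n : ℚ) + 1) ^ (n - 1) := by
  rw [Finset.sum_congr rfl fun lam _ => aux_term n hn lam, ← Finset.mul_sum]
  have key := aux_coeff n
  rw [← Finset.sum_bij (s := (Finset.univ : Finset n.Partition))
    (f := fun lam => (Nat.multinomial (Finset.range (n + 1)) (auxK n lam) : ℚ) *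
        ∏ i ∈ Finset.range (n + 1), (1 / (i.factorial : ℚ)) ^ auxK n lam i)
    (fun lam _ => auxK n lam) ?_ ?_ ?_ (fun _ _ => rfl)] at key
  · rw [key]
    obtain ⟨m, rfl⟩ : ∃ m, n = m + 1 := ⟨n - 1, by omega⟩
    have : ((m + 1 : ℕ) : ℚ) + 1 ≠ 0 := by positivity
    have h2 : ((m + 1).factorial : ℚ) ≠ 0 := by positivity
    rw [Nat.add_sub_cancel, pow_succ]
    field_simp
  · intro lam _
    have hl := aux_card_le lam
    rw [Finset.mem_filter, Finset.mem_piAntidiag]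
    refine ⟨⟨?_, ?_⟩, ?_⟩
    · rw [Finset.sum_range_succ']
      simp only [auxK, Nat.succ_ne_zero, if_false, if_true, aux_sum_count]
      omega
    · intro i hi
      by_cases h0 : i = 0
      · simp [h0]
      · simp only [auxK, h0, if_false] at hi
        exact aux_mem lam i (by simpa using hi)
    · have h := lam.parts_sum
      rw [Finset.sum_multiset_count,
        Finset.sum_subset (s₂ := Finset.range (n + 1))
          (fun a ha => aux_mem lam a (by simpa using ha))
          (fun a _ ha => by
            rw [Multiset.count_eq_zero_of_notMem (by simpa using ha), zero_smul])] at h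
      conv_rhs => rw [← h]
      refine Finset.sum_congr rfl fun i _ => ?_
      by_cases h0 : i = 0
      · simp [h0]
      · simp [auxK, h0, mul_comm]
  · intro a _ b _ hab
    apply Nat.Partition.ext
    ext i
    by_cases h0 : i = 0
    · rw [h0, aux_count_zero, aux_count_zero]
    · have := congrFun hab i
      simpa [auxK, h0] using this
  · intro k hk
    rw [Finset.mem_filter, Finset.mem_piAntidiag] at hk
    obtain ⟨⟨hk1, hk2⟩, hk3⟩ := hk
    have hs : (∑ i ∈ Finset.range (n + 1), Multiset.replicate (k i) i).sum = n := by
      rw [Multiset.sum_sum]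
      conv_rhs => rw [← hk3]
      simp [mul_comm]
    have hc : ∀ i, i ≠ 0 → (Nat.Partition.ofSums n _ hs).parts.count i = k i := by
      intro i hi
      rw [Nat.Partition.count_ofSums_of_ne_zero hs hi, Multiset.count_sum']
      simp only [Multiset.count_replicate]
      by_cases h : k i = 0
      · rw [h]
        refine Finset.sum_eq_zero fun j _ => ?_
        split_ifs with hj
        · rw [hj, h]
        · rfl
      · rw [Finset.sum_ite_eq' , if_pos (hk2 i h)]
    refine ⟨Nat.Partition.ofSums n _ hs, Finset.mem_univ _, ?_⟩
    funext i
    by_cases h0 : i = 0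
    · subst h0
      have h1 := aux_sum_count (Nat.Partition.ofSums n _ hs)
      rw [Finset.sum_congr rfl fun i _ => hc (i + 1) (Nat.succ_ne_zero i)] at h1
      rw [Finset.sum_range_succ'] at hk1
      simp only [auxK, if_true]
      omega
    · simp only [auxK, h0, if_false]
      exact hc i h0
end

section
/- For n ≥ 1, Σ over partitions λ of n into odd parts of [2^{ℓ}/ℓ! · multinomial(ℓ; m_1, m_3, ...) · (n+ℓ-1)(n+ℓ-3)⋯(n-ℓ+3)] · 2^{n-ℓ} · multinomial(n; λ_1,...,λ_ℓ) = 2^n (n+1)^{n-1}, where ℓ = ℓ(λ). -/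
namespace St13
open PowerSeries Finset

noncomputable def S : PowerSeries ℚ := PowerSeries.mk fun i => if Odd i then (1 : ℚ) / i.factorial else 0
noncomputable def Csh : PowerSeries ℚ := PowerSeries.mk fun i => if Odd i then 0 else (1 : ℚ) / i.factorial

lemma dS : derivative ℚ S = Csh := by
  ext n
  rw [coeff_derivative]
  simp only [S, Csh, coeff_mk, Nat.odd_add_one]
  by_cases h : Odd n
  · simp [h]
  · simp only [h, not_false_eq_true, if_true, if_false, Nat.factorial_succ]
    push_cast
    field_simp

lemma dC : derivative ℚ Csh = S := by
  ext n
  rw [coeff_derivative]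
  simp only [S, Csh, coeff_mk, Nat.odd_add_one]
  by_cases h : Odd n
  · simp only [h, not_true_eq_false, if_true, if_false, Nat.factorial_succ]
    push_cast
    field_simp
  · simp [h]

lemma CC : Csh ^ 2 = 1 + S ^ 2 := by
  apply PowerSeries.derivative.ext
  · simp only [map_add, Derivation.leibniz_pow, dS, dC]
    simp [mul_comm]
  · simp only [map_add, map_pow, map_one, ← coeff_zero_eq_constantCoeff_apply, S, Csh, coeff_mk]
    simp

lemma ddS (l : ℕ) : derivative ℚ (derivative ℚ (S ^ (l + 2))) =
    ((l + 2) * (l + 1) : ℚ) • S ^ l + ((l + 2) ^ 2 : ℚ) • S ^ (l + 2) := by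
  simp only [Derivation.leibniz_pow, Derivation.leibniz, map_nsmul, dS, dC, smul_eq_mul, nsmul_eq_mul,
    PowerSeries.smul_eq_C_mul, map_mul, map_add, map_pow, map_natCast, map_ofNat, map_one,
    Nat.add_sub_cancel, show l + 2 - 1 = l + 1 from rfl]
  push_cast
  have h0 : derivative ℚ ((l : PowerSeries ℚ) + 2) = 0 := by
    have := Derivation.map_natCast (derivative ℚ : Derivation ℚ (PowerSeries ℚ) _) (l + 2)
    simpa using this
  rw [h0]
  linear_combination ((l + 2) * (l + 1) * S ^ l : PowerSeries ℚ) * CC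

noncomputable def U (n l : ℕ) : ℚ := n.factorial * coeff n (S ^ l) / l.factorial

lemma coeff_dd (f : PowerSeries ℚ) (n : ℕ) : (n.factorial : ℚ) * coeff n (derivative ℚ (derivative ℚ f))
    = (n + 2).factorial * coeff (n + 2) f := by
  simp only [coeff_derivative, Nat.factorial_succ]
  push_cast
  ring

lemma U_rec (n l : ℕ) : U (n + 2) (l + 2) = ((l : ℚ) + 2) ^ 2 * U n (l + 2) + U n l := by
  unfold U
  rw [← coeff_dd, ddS]
  simp only [map_add, PowerSeries.coeff_smul, Nat.factorial_succ]
  push_cast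
  have := Nat.factorial_ne_zero l
  field_simp
  ring

lemma U_one (n : ℕ) : U (n + 2) 1 = U n 1 := by
  unfold U
  rw [← coeff_dd, pow_one, dS, dC]

lemma U_zero (n : ℕ) : U (n + 2) 0 = 0 := by
  unfold U
  simp [coeff_one]

lemma U_lt {n l : ℕ} (h : n < l) : U n l = 0 := by
  have h1 : (X : PowerSeries ℚ) ∣ S := by
    rw [X_dvd_iff]
    simp [S, ← coeff_zero_eq_constantCoeff_apply]
  have := X_pow_dvd_iff.1 (pow_dvd_pow_of_dvd h1 l) n h
  simp [U, this]

def c (a : ℚ) : ℕ → ℚ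
  | 0 => 1
  | 1 => a
  | (l + 2) => (a ^ 2 - (l : ℚ) ^ 2) * c a l

lemma c_succ (a : ℚ) : ∀ l : ℕ, c a (l + 1) = a * ∏ j ∈ range l, (a + l - 1 - 2 * j)
  | 0 => by simp [c]
  | 1 => by simp [c]; ring
  | (l + 2) => by
    rw [show l + 2 + 1 = (l + 1) + 2 from rfl, c, c_succ a l, prod_range_succ, prod_range_succ']
    push_cast
    have : ∏ k ∈ range l, (a + (l + 2) - 1 - 2 * ((k : ℚ) + 1)) = ∏ j ∈ range l, (a + l - 1 - 2 * j) :=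
      prod_congr rfl fun j _ => by ring
    rw [this]
    ring

lemma main (a : ℚ) : ∀ n N : ℕ, n < N → ∑ l ∈ range N, U n l * c a l = a ^ n
  | 0, N + 1, _ => by
    rw [sum_range_succ', sum_eq_zero fun l _ => by rw [U_lt (by omega), zero_mul]]
    simp [U, c]
  | 1, 1, h => by omega
  | 1, N + 2, _ => by
    rw [sum_range_succ', sum_range_succ', sum_eq_zero fun l _ => by rw [U_lt (by omega), zero_mul]]
    simp [U, c, S, coeff_one]
  | (n + 2), 0, h => by omega
  | (n + 2), 1, h => by omega
  | (n + 2), N + 2, h => by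
    have ih := main a n N (by omega)
    have h1 : ∑ l ∈ range (N + 2), (l : ℚ) ^ 2 * U n l * c a l = ∑ l ∈ range N, (l : ℚ) ^ 2 * U n l * c a l := by
      rw [sum_range_succ, sum_range_succ, U_lt (show n < N by omega), U_lt (show n < N + 1 by omega)]
      simp
    have h2 : ∑ l ∈ range (N + 2), U (n + 2) l * c a l =
        ∑ l ∈ range (N + 2), (l : ℚ) ^ 2 * U n l * c a l + ∑ l ∈ range N, U n l * c a (l + 2) := by
      rw [sum_range_succ', sum_range_succ', sum_range_succ', sum_range_succ', U_zero, U_one]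
      simp only [U_rec, add_mul, sum_add_distrib]
      push_cast
      simp only [add_assoc]
      norm_num
      ring
    rw [h2, h1, ← sum_add_distrib, pow_add, ← ih, sum_mul]
    refine sum_congr rfl fun l _ => ?_
    rw [c]
    ring

lemma coeff_trunc (n l : ℕ) : coeff n (S ^ l) =
    coeff n ((∑ i ∈ (range (n + 1)).filter Odd, monomial i ((1 : ℚ) / i.factorial)) ^ l) := by
  have h1 : (X : PowerSeries ℚ) ^ (n + 1) ∣
      S - ∑ i ∈ (range (n + 1)).filter Odd, monomial i ((1 : ℚ) / i.factorial) := by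
    rw [X_pow_dvd_iff]
    intro m hm
    rw [map_sub, map_sum]
    simp only [coeff_monomial, sum_ite_eq, mem_filter, mem_range, hm, true_and]
    simp [S]
  have := X_pow_dvd_iff.1 (h1.trans (sub_dvd_pow_sub_pow _ _ l)) n (by omega)
  rw [map_sub] at this
  linarith

lemma prod_mono (m : Multiset ℕ) :
    (m.map fun i => (monomial i ((1 : ℚ) / i.factorial) : PowerSeries ℚ)).prod =
    monomial m.sum (1 / (m.map (fun p => (p.factorial : ℚ))).prod) := by
  induction m using Multiset.induction_on with
  | empty => simp [monomial_zero_eq_C]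
  | cons a s ih =>
    simp only [Multiset.map_cons, Multiset.prod_cons, Multiset.sum_cons, ih, monomial_mul_monomial]
    congr 1
    field_simp

lemma multinom (n : ℕ) (lam : n.Partition) : (lam.parts.countPerms : ℚ) =
    (lam.parts.card.factorial : ℚ) /
          ∏ i ∈ Finset.range (n + 1), ((lam.parts.count i).factorial : ℚ) := by
  have hsub : lam.parts.toFinset ⊆ range (n + 1) := by
    intro i hi
    rw [Multiset.mem_toFinset] at hi
    have := Multiset.le_sum_of_mem hi
    rw [lam.parts_sum] at this
    simp; omega
  have h2 := Nat.multinomial_spec lam.parts.toFinset (fun i => lam.parts.count i)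
  have h1 : lam.parts.countPerms = Nat.multinomial lam.parts.toFinset (fun i => lam.parts.count i) := by
    rw [Multiset.countPerms, Finsupp.multinomial_eq]
    simp
    rfl
  rw [← h1, Multiset.toFinset_sum_count_eq] at h2
  rw [← prod_subset hsub (fun i _ hi => by
    rw [Multiset.mem_toFinset] at hi
    simp [Multiset.count_eq_zero_of_notMem hi]), ← h2]
  have h3 : ∏ i ∈ lam.parts.toFinset, ((lam.parts.count i).factorial : ℚ) ≠ 0 :=
    prod_ne_zero_iff.2 fun i _ => by exact_mod_cast Nat.factorial_ne_zero _
  rw [eq_div_iff h3]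
  push_cast
  ring

lemma coeff_part (n l : ℕ) : coeff n (S ^ l) =
    ∑ lam ∈ (Finset.univ.filter (fun lam : n.Partition => ∀ i ∈ lam.parts, Odd i)).filter
      (fun lam => lam.parts.card = l),
      (lam.parts.countPerms : ℚ) * (1 / (lam.parts.map (fun p => (p.factorial : ℚ))).prod) := by
  rw [coeff_trunc, Finset.sum_pow, map_sum]
  simp only [prod_mono, ← nsmul_eq_mul, map_nsmul, coeff_monomial]
  simp only [smul_ite, smul_zero]
  rw [← sum_filter]
  symm
  refine sum_bij (fun lam h => (⟨lam.parts, (mem_filter.1 h).2⟩ : Sym ℕ l)) ?_ ?_ ?_ ?_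
  · intro lam h
    simp only [mem_filter, mem_univ, true_and] at h
    refine mem_filter.2 ⟨mem_sym_iff.2 fun i hi => mem_filter.2 ⟨mem_range.2 ?_, h.1 i hi⟩,
      lam.parts_sum.symm⟩
    have := Multiset.le_sum_of_mem (show i ∈ lam.parts from hi)
    rw [lam.parts_sum] at this
    omega
  · intro a _ b _ h
    exact Nat.Partition.ext (congrArg Subtype.val h)
  · intro k hk
    simp only [mem_filter, mem_sym_iff, mem_range] at hk
    refine ⟨⟨k.1, fun {i} hi => (hk.1 i hi).2.pos, hk.2.symm⟩, ?_, rfl⟩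
    simp only [mem_filter, mem_univ, true_and]
    exact ⟨fun i hi => (hk.1 i hi).2, k.2⟩
  · intro lam h
    rfl

end St13


/-- For `n ≥ 1`, summing over partitions `λ` of `n` into odd parts, with
`ℓ = ℓ(λ)` parts and `m_i` parts equal to `i`:
`Σ_λ [2^ℓ/ℓ!·(ℓ!/∏ m_i!)·(n+ℓ-1)(n+ℓ-3)⋯(n-ℓ+3)]·2^(n-ℓ)·(n!/∏ λ_j!)
 = 2^n (n+1)^(n-1)`.
The product `(n+ℓ-1)(n+ℓ-3)⋯(n-ℓ+3)` has `ℓ-1` factors decreasing by 2. -/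
theorem statement13 (n : ℕ) (hn : 1 ≤ n) :
    ∑ lam ∈ Finset.univ.filter (fun lam : n.Partition => ∀ i ∈ lam.parts, Odd i),
      ((2 : ℚ) ^ lam.parts.card / (lam.parts.card.factorial : ℚ) *
        ((lam.parts.card.factorial : ℚ) /
          ∏ i ∈ Finset.range (n + 1), ((lam.parts.count i).factorial : ℚ)) *
        ∏ j ∈ Finset.range (lam.parts.card - 1),
          ((n : ℚ) + lam.parts.card - 1 - 2 * j)) *
      2 ^ (n - lam.parts.card) *
      ((n.factorial : ℚ) / (lam.parts.map (fun p => (p.factorial : ℚ))).prod) =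
      2 ^ n * ((n : ℚ) + 1) ^ (n - 1) := by
  have key : ∀ lam ∈ Finset.univ.filter (fun lam : n.Partition => ∀ i ∈ lam.parts, Odd i),
      ((2 : ℚ) ^ lam.parts.card / (lam.parts.card.factorial : ℚ) *
        ((lam.parts.card.factorial : ℚ) /
          ∏ i ∈ Finset.range (n + 1), ((lam.parts.count i).factorial : ℚ)) *
        ∏ j ∈ Finset.range (lam.parts.card - 1),
          ((n : ℚ) + lam.parts.card - 1 - 2 * j)) *
      2 ^ (n - lam.parts.card) *
      ((n.factorial : ℚ) / (lam.parts.map (fun p => (p.factorial : ℚ))).prod) =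
      2 ^ n / (n + 1) * (n.factorial / lam.parts.card.factorial *
        (((lam.parts.countPerms : ℚ) * (1 / (lam.parts.map (fun p => (p.factorial : ℚ))).prod)) *
        St13.c (n + 1) lam.parts.card)) := by
    intro lam _
    rw [← St13.multinom]
    have hle : lam.parts.card ≤ n := by
      have h := Multiset.card_nsmul_le_sum (s := lam.parts) (a := 1)
        (fun x hx => lam.parts_pos hx)
      rw [lam.parts_sum] at h
      simpa using h
    have hpos : lam.parts.card ≠ 0 := by
      intro h
      have h1 := lam.parts_sum
      rw [Multiset.card_eq_zero.1 h] at h1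
      simp at h1
      omega
    obtain ⟨k, hk⟩ := Nat.exists_eq_succ_of_ne_zero hpos
    have hpow : (2 : ℚ) ^ n = 2 ^ lam.parts.card * 2 ^ (n - lam.parts.card) := by
      rw [← pow_add]; congr 1; omega
    have hc : St13.c (n + 1) lam.parts.card = ((n : ℚ) + 1) *
        ∏ j ∈ Finset.range (lam.parts.card - 1), ((n : ℚ) + lam.parts.card - 1 - 2 * j) := by
      rw [hk, Nat.succ_eq_add_one, St13.c_succ]
      congr 1
      refine Finset.prod_congr rfl fun j _ => ?_
      push_cast
      ring
    rw [hc, hpow]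
    have hn1 : (n : ℚ) + 1 ≠ 0 := by positivity
    field_simp
  rw [Finset.sum_congr rfl key, ← Finset.mul_sum]
  have hmaps : ∀ lam ∈ Finset.univ.filter (fun lam : n.Partition => ∀ i ∈ lam.parts, Odd i),
      lam.parts.card ∈ Finset.range (n + 1) := by
    intro lam _
    have h := Multiset.card_nsmul_le_sum (s := lam.parts) (a := 1)
      (fun x hx => lam.parts_pos hx)
    rw [lam.parts_sum] at h
    simp at h ⊢
    omega
  rw [← Finset.sum_fiberwise_of_maps_to hmaps]
  have hfin := St13.main ((n : ℚ) + 1) n (n + 1) (by omega)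
  have hrw : ∀ l ∈ Finset.range (n + 1), St13.U n l * St13.c ((n : ℚ) + 1) l =
      ∑ lam ∈ (Finset.univ.filter (fun lam : n.Partition => ∀ i ∈ lam.parts, Odd i)).filter
      (fun lam => lam.parts.card = l), (n.factorial / lam.parts.card.factorial *
        (((lam.parts.countPerms : ℚ) * (1 / (lam.parts.map (fun p => (p.factorial : ℚ))).prod)) *
        St13.c (n + 1) lam.parts.card)) := by
    intro l _
    rw [St13.U, St13.coeff_part, mul_div_right_comm, Finset.mul_sum, Finset.sum_mul]
    refine Finset.sum_congr rfl fun lam h => ?_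
    rw [(Finset.mem_filter.1 h).2]
    ring
  rw [← Finset.sum_congr rfl hrw, hfin]
  obtain ⟨m, rfl⟩ : ∃ m, n = m + 1 := ⟨n - 1, by omega⟩
  have hn1 : ((m + 1 : ℕ) : ℚ) + 1 ≠ 0 := by positivity
  rw [Nat.add_sub_cancel, pow_succ (((m + 1 : ℕ) : ℚ) + 1)]
  field_simp
end
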